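/- Let Ω ⊂ ℝ^d be open, let f : Ω → ℝ be locally bounded, let x₀ ∈ Ω, and let l ∈ ℕ with l > h_f(x₀). Then the pointwise Hölder exponent of f at x₀ is recovered from the decay of the oscillations of order l on the enlarged dyadic cubes containing x₀: h_f(x₀) = liminf_{j→∞} (log Osc^l_f(3λ_j(x₀)))/(log 2^{-j}), the liminf being taken over those j large enough that 3λ_j(x₀) ⊂ Ω. -/

import Mathlib

open MeasureTheory Filter Metric Set
open scoped ENNReal Topology

noncomputable section

/-- The dyadic cube of scale `j` with index `k`:
`λ = ∏_i [k_i 2^{-j}, (k_i+1) 2^{-j})`. -/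
def dyadicCube (d : ℕ) (j : ℕ) (k : Fin d → ℤ) : Set (Fin d → ℝ) :=
  {y | ∀ i, (k i : ℝ) * 2 ^ (-(j : ℤ)) ≤ y i ∧ y i < ((k i : ℝ) + 1) * 2 ^ (-(j : ℤ))}

/-- The index of the unique dyadic cube of scale `j` containing `x`. -/
def dyadicIndex (d : ℕ) (j : ℕ) (x : Fin d → ℝ) : Fin d → ℤ :=
  fun i => ⌊x i * 2 ^ (j : ℕ)⌋

/-- `3λ`: the cube with the same center as the dyadic cube `λ` of scale `j` and
index `k`, and three times its side length. -/
def threeCube (d : ℕ) (j : ℕ) (k : Fin d → ℤ) : Set (Fin d → ℝ) :=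
  {y | ∀ i, ((k i : ℝ) - 1) * 2 ^ (-(j : ℤ)) ≤ y i ∧ y i < ((k i : ℝ) + 2) * 2 ^ (-(j : ℤ))}

/-- Iterated finite differences: `Δ⁰_h f = f` and
`Δ^{l+1}_h f(x) = Δ^l_h f(x+h) − Δ^l_h f(x)`, so that
`Δ¹_h f(x) = f(x+h) − f(x)`. -/
def iteratedDiff {d : ℕ} (f : (Fin d → ℝ) → ℝ) : ℕ → (Fin d → ℝ) → (Fin d → ℝ) → ℝ
  | 0, _, x => f x
  | l + 1, h, x => iteratedDiff f l h (x + h) - iteratedDiff f l h x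

/-- The oscil of order `l` of `f` on a set `A`:
`Osc^l_f(A) = sup{|Δ^l_h f(x)| : x ∈ A, x + l·h ∈ A}`. -/
def oscil {d : ℕ} (l : ℕ) (f : (Fin d → ℝ) → ℝ) (A : Set (Fin d → ℝ)) : ℝ :=
  sSup {t : ℝ | ∃ x h : Fin d → ℝ, x ∈ A ∧ x + (l : ℝ) • h ∈ A ∧
    t = |iteratedDiff f l h x|}

/-- `f ∈ C^α(x₀)`: there exist `C, R > 0` and a polynomial `P` of (total) degree at
most `α` with `|f(x) − P(x−x₀)| ≤ C|x−x₀|^α` whenever `|x−x₀| ≤ R`. -/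
def HolderAt {d : ℕ} (f : (Fin d → ℝ) → ℝ) (x₀ : Fin d → ℝ) (α : ℝ) : Prop :=
  ∃ C R : ℝ, 0 < C ∧ 0 < R ∧ ∃ P : MvPolynomial (Fin d) ℝ,
    (P.totalDegree : ℝ) ≤ α ∧
    ∀ x : Fin d → ℝ, ‖x - x₀‖ ≤ R →
      |f x - MvPolynomial.eval (fun i => x i - x₀ i) P| ≤ C * ‖x - x₀‖ ^ α

/-- The pointwise Hölder exponent `h_f(x₀) = sup{α ≥ 0 : f ∈ C^α(x₀)}`, valued in
the extended reals. -/
def holderExp {d : ℕ} (f : (Fin d → ℝ) → ℝ) (x₀ : Fin d → ℝ) : EReal :=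
  sSup {h : EReal | ∃ α : ℝ, 0 ≤ α ∧ HolderAt f x₀ α ∧ h = (α : EReal)}

theorem Convex.add_natCast_smul_mem {E : Type*} [AddCommGroup E] [Module ℝ E] {s : Set E}
    (hs : Convex ℝ s) {x h : E} {n k : ℕ} (hx : x ∈ s) (hxh : x + (n : ℝ) • h ∈ s) (hk : k ≤ n) :
    x + (k : ℝ) • h ∈ s := by
  rcases Nat.eq_zero_or_pos n with rfl | hn
  · obtain rfl : k = 0 := by omega
    simpa using hx
  have hn' : (0 : ℝ) < n := by exact_mod_cast hn
  have hk' : (k : ℝ) ≤ n := by exact_mod_cast hk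
  have := hs.add_smul_mem hx hxh (t := (k : ℝ) / n)
    ⟨by positivity, (div_le_one hn').2 hk'⟩
  rwa [smul_smul, div_mul_cancel₀ _ hn'.ne'] at this

theorem abs_fwdDiff_iter_le {M : Type*} [AddCommMonoid M] {F : M → ℝ} {h x : M} {n : ℕ} {A : ℝ}
    (hF : ∀ k ≤ n, |F (x + k • h)| ≤ A) : |(fwdDiff h)^[n] F x| ≤ 2 ^ n * A := by
  induction n generalizing x with
  | zero => simpa using hF 0 le_rfl
  | succ n ih =>
    have h1 := ih (x := x) fun k hk => hF k (by omega)
    have h2 := ih (x := x + h) fun k hk => by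
      have := hF (k + 1) (by omega)
      rwa [succ_nsmul', ← add_assoc] at this
    rw [Function.iterate_succ_apply', fwdDiff, pow_succ]
    refine (abs_sub _ _).trans ?_
    linarith

theorem fwdDiff_iter_comp {M N G : Type*} [AddCommMonoid M] [AddCommMonoid N] [AddCommGroup G]
    (F : N → G) (φ : M → N) (s : M) (h : N) (hφ : ∀ y, φ (y + s) = φ y + h) (n : ℕ) (y : M) :
    (fwdDiff s)^[n] (fun t => F (φ t)) y = (fwdDiff h)^[n] F (φ y) := by
  induction n generalizing y with
  | zero => rfl
  | succ n ih =>
    rw [Function.iterate_succ_apply', Function.iterate_succ_apply']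
    simp only [fwdDiff, ih, hφ]

theorem fwdDiff_iter_sub {M G : Type*} [AddCommMonoid M] [AddCommGroup G]
    (f g : M → G) (h : M) (n : ℕ) (y : M) :
    (fwdDiff h)^[n] (fun t => f t - g t) y = (fwdDiff h)^[n] f y - (fwdDiff h)^[n] g y := by
  induction n generalizing y with
  | zero => rfl
  | succ n ih =>
    simp only [Function.iterate_succ_apply', fwdDiff, ih]
    abel

theorem Polynomial.natDegree_lt_of_degree_lt_cast {R : Type*} [Semiring R] {p : Polynomial R}
    {l : ℕ} (hl : 0 < l) (hp : p.degree < l) : p.natDegree < l := by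
  rcases eq_or_ne p 0 with rfl | h0
  · simpa using hl
  · exact (Polynomial.natDegree_lt_iff_degree_lt h0).2 hp

theorem Polynomial.fwdDiff_iter_eval_eq_zero {R : Type*} [CommRing R] {p : Polynomial R} {l : ℕ}
    (hp : p.degree < l) (h y : R) : (fwdDiff h)^[l] (fun t => p.eval t) y = 0 := by
  rcases Nat.eq_zero_or_pos l with rfl | hl
  · have : p = 0 := by simpa [Polynomial.degree_eq_bot] using hp
    simp [this]
  have hd : p.natDegree < l := Polynomial.natDegree_lt_of_degree_lt_cast hl hp
  let q : Polynomial R := p.comp (Polynomial.C y + Polynomial.C h * Polynomial.X)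
  have hq : q.natDegree < l := by
    refine lt_of_le_of_lt Polynomial.natDegree_comp_le ?_
    refine lt_of_le_of_lt (Nat.mul_le_mul_left _ (m := 1) ?_) (by simpa using hd)
    compute_degree
  have key := fwdDiff_iter_comp (fun t => p.eval t) (fun t : R => y + h * t) 1 h
    (fun t => by ring) l 0
  have hz := congrFun (Polynomial.fwdDiff_iter_eq_zero_of_degree_lt hq) 0
  have he : (fun t => p.eval (y + h * t)) = fun t => q.eval t := by
    funext t; simp [q]
  rw [he] at key
  simp only [mul_zero, add_zero] at key
  rw [← key]; exact hz

/-- A sequence whose first `l` terms vanish and whose differences of order `l` are small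
is small. -/
theorem abs_le_of_fwdDiff_iter_le {l n : ℕ} {δ : ℝ} (hδ : 0 ≤ δ) (b : ℕ → ℝ) (h0 : ∀ i < l, b i = 0)
    (hb : ∀ i, i + l ≤ n → |(fwdDiff 1)^[l] b i| ≤ δ) (k : ℕ) (hk : k ≤ n) :
    |b k| ≤ (n : ℝ) ^ l * δ := by
  induction l generalizing b n k with
  | zero => simpa using hb k hk
  | succ l ih =>
    have hd : ∀ k < n, |fwdDiff 1 b k| ≤ (n : ℝ) ^ l * δ := by
      intro k hk
      have := ih (n := n - 1) (fwdDiff 1 b)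
        (fun i hi => by simp [fwdDiff, h0 i (by omega), h0 (i + 1) (by omega)])
        (fun i hi => by simpa using hb i (by omega)) k (by omega)
      refine this.trans ?_
      gcongr
      omega
    have hs : ∀ k ≤ n, |b k| ≤ k * ((n : ℝ) ^ l * δ) := by
      intro k
      induction k with
      | zero => simp [h0 0]
      | succ k ihk =>
        intro hk
        have h1 := ihk (by omega)
        have h2 := hd k (by omega)
        have h3 : b (k + 1) = b k + fwdDiff 1 b k := by simp [fwdDiff]
        rw [h3]
        refine (abs_add_le _ _).trans ?_
        push_cast
        linarith
    calc |b k| ≤ k * ((n : ℝ) ^ l * δ) := hs k hk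
      _ ≤ n * ((n : ℝ) ^ l * δ) := by gcongr
      _ = _ := by ring

/-- The Lagrange basis for the nodes `0, …, l - 1`. -/
abbrev natBasis (l : ℕ) (i : Fin l) : Polynomial ℝ :=
  Lagrange.basis Finset.univ (fun j : Fin l => (j : ℝ)) i

theorem injOn_natCast_fin (l : ℕ) :
    Set.InjOn (fun j : Fin l => (j : ℝ)) (Finset.univ : Finset (Fin l)) := by
  intro i _ j _ h
  exact Fin.ext (Nat.cast_injective h)

theorem Polynomial.eval_mul_eq_sum_natBasis {p : Polynomial ℝ} {l : ℕ} (hp : p.degree < l)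
    (K x : ℝ) : p.eval (K * x) = ∑ i : Fin l, p.eval (K * i) * (natBasis l i).eval x := by
  let q : Polynomial ℝ := p.comp (Polynomial.C K * Polynomial.X)
  have hq : q.degree < (Finset.univ : Finset (Fin l)).card := by
    rw [Finset.card_univ, Fintype.card_fin]
    rcases eq_or_ne p 0 with rfl | h0
    · simp [q]
    · have : p.natDegree < l := (Polynomial.natDegree_lt_iff_degree_lt h0).2 hp
      refine lt_of_le_of_lt Polynomial.degree_le_natDegree ?_
      have h2 : q.natDegree ≤ p.natDegree * 1 := by
        refine Polynomial.natDegree_comp_le.trans (Nat.mul_le_mul_left _ ?_)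
        compute_degree
      exact_mod_cast lt_of_le_of_lt h2 (by simpa using this)
  have h := congrArg (Polynomial.eval x) (Lagrange.eq_interpolate (injOn_natCast_fin l) hq)
  simpa [q, Lagrange.interpolate_apply, Polynomial.eval_finsetSum] using h

/-- Along an arithmetic progression, a function with small differences of order `l` is close to
a polynomial of degree less than `l`. -/
theorem exists_polynomial_near_progression {l n : ℕ} {δ : ℝ} (hδ : 0 ≤ δ) {I : Set ℝ}
    (hI : Convex ℝ I) (g : ℝ → ℝ)
    (hg : ∀ x h, x ∈ I → x + l * h ∈ I → |(fwdDiff h)^[l] g x| ≤ δ)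
    {x h : ℝ} (hx : x ∈ I) (hxh : x + n * h ∈ I) :
    ∃ p : Polynomial ℝ, p.degree < l ∧
      ∀ k ≤ n, x + k * h ∈ I ∧ |g (x + k * h) - p.eval (k : ℝ)| ≤ (n : ℝ) ^ l * δ := by
  have hmem : ∀ k ≤ n, x + k * h ∈ I := fun k hk => hI.add_natCast_smul_mem hx hxh hk
  let p := Lagrange.interpolate Finset.univ (fun j : Fin l => (j : ℝ)) (fun j => g (x + j * h))
  have hp : p.degree < l := by
    have := Lagrange.degree_interpolate_lt (fun j : Fin l => g (x + j * h)) (injOn_natCast_fin l)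
    rwa [Finset.card_univ, Fintype.card_fin] at this
  refine ⟨p, hp, fun k hk => ⟨hmem k hk, ?_⟩⟩
  refine abs_le_of_fwdDiff_iter_le (l := l) hδ (fun k : ℕ => g (x + k * h) - p.eval (k : ℝ))
    ?_ ?_ k hk
  · intro i hi
    have := Lagrange.eval_interpolate_at_node (fun j : Fin l => g (x + j * h))
      (injOn_natCast_fin l) (Finset.mem_univ ⟨i, hi⟩)
    simp only [p]
    simp only at this
    rw [this, sub_self]
  · intro i hi
    rw [fwdDiff_iter_sub,
      fwdDiff_iter_comp g (fun k : ℕ => x + k * h) 1 h (fun y => by push_cast; ring),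
      fwdDiff_iter_comp (fun t => p.eval t) (fun k : ℕ => (k : ℝ)) 1 1 (fun y => by push_cast; ring),
      Polynomial.fwdDiff_iter_eval_eq_zero hp, sub_zero]
    refine hg _ _ (hmem i (by omega)) ?_
    have := hmem (i + l) hi
    push_cast at this
    convert this using 1
    ring

theorem exists_step_abs_sub_le {l : ℕ} (hl : 0 < l) {η : ℝ} (hη : 0 < η) :
    ∃ K : ℕ, 0 < K ∧ ∀ (p : Polynomial ℝ) (A : ℝ), p.degree < l →
      (∀ i < l, |p.eval ((K * i : ℕ) : ℝ)| ≤ A) → |p.eval 1 - p.eval 0| ≤ η * A := by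
  have ht : Tendsto (fun x : ℝ => ∑ i : Fin l, |(natBasis l i).eval x - (natBasis l i).eval 0|)
      (𝓝 0) (𝓝 0) := by
    have : Continuous
        (fun x : ℝ => ∑ i : Fin l, |(natBasis l i).eval x - (natBasis l i).eval 0|) := by
      fun_prop
    simpa using this.tendsto 0
  have ht2 := ht.comp (tendsto_one_div_add_atTop_nhds_zero_nat (𝕜 := ℝ))
  obtain ⟨k, hk⟩ := (ht2.eventually (gt_mem_nhds hη)).exists
  refine ⟨k + 1, k.succ_pos, fun p A hp hA => ?_⟩
  have hk0 : ((k + 1 : ℕ) : ℝ) ≠ 0 := by positivity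
  have h1 := Polynomial.eval_mul_eq_sum_natBasis hp (k + 1 : ℕ) (1 / ((k : ℝ) + 1))
  have h2 := Polynomial.eval_mul_eq_sum_natBasis hp (k + 1 : ℕ) 0
  rw [show ((k + 1 : ℕ) : ℝ) * (1 / ((k : ℝ) + 1)) = 1 by push_cast; field_simp] at h1
  rw [mul_zero] at h2
  rw [h1, h2, ← Finset.sum_sub_distrib]
  have hA0 : 0 ≤ A := (abs_nonneg _).trans (hA 0 hl)
  calc |∑ i : Fin l, (p.eval (((k + 1 : ℕ) : ℝ) * i) * (natBasis l i).eval (1 / ((k : ℝ) + 1))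
        - p.eval (((k + 1 : ℕ) : ℝ) * i) * (natBasis l i).eval 0)|
      ≤ ∑ i : Fin l, |(natBasis l i).eval (1 / ((k : ℝ) + 1)) - (natBasis l i).eval 0| * A := by
        refine (Finset.abs_sum_le_sum_abs _ _).trans (Finset.sum_le_sum fun i _ => ?_)
        rw [← mul_sub, abs_mul, mul_comm]
        gcongr
        have := hA i i.2
        push_cast at this ⊢
        exact this
    _ ≤ η * A := by
        rw [← Finset.sum_mul]
        gcongr
        exact hk.le

theorem exists_abs_eval_le_of_nodes (l : ℕ) {N : ℕ} (hN : 0 < N) :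
    ∃ D : ℝ, 0 ≤ D ∧ ∀ (p : Polynomial ℝ) (A : ℝ), p.degree < l →
      (∀ i < l, |p.eval ((N * i : ℕ) : ℝ)| ≤ A) → ∀ k ≤ l * N, |p.eval (k : ℝ)| ≤ D * A := by
  refine ⟨∑ k ∈ Finset.range (l * N + 1), ∑ i : Fin l, |(natBasis l i).eval ((k : ℝ) / N)|,
    by positivity, fun p A hp hA k hk => ?_⟩
  rcases Nat.eq_zero_or_pos l with rfl | hl
  · have : p = 0 := by simpa [Polynomial.degree_eq_bot] using hp
    simp [this]
  have hA0 : 0 ≤ A := (abs_nonneg _).trans (hA 0 hl)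
  have h1 := Polynomial.eval_mul_eq_sum_natBasis hp N (k / N)
  rw [mul_div_cancel₀ _ (by positivity)] at h1
  have h2 : |p.eval (k : ℝ)| ≤ (∑ i : Fin l, |(natBasis l i).eval ((k : ℝ) / N)|) * A := by
    rw [h1, Finset.sum_mul]
    refine (Finset.abs_sum_le_sum_abs _ _).trans (Finset.sum_le_sum fun i _ => ?_)
    rw [abs_mul, mul_comm]
    gcongr
    have := hA i i.2
    push_cast at this
    exact this
  refine h2.trans ?_
  gcongr
  exact Finset.single_le_sum
    (f := fun k : ℕ => ∑ i : Fin l, |(natBasis l i).eval ((k : ℝ) / N)|)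
    (fun _ _ => by positivity) (Finset.mem_range.2 (by omega))

theorem exists_grid_point_near {m : ℕ} {K : ℕ} (hm : 0 < m) (hmK : 2 * K ≤ m) {x : ℝ}
    (hx : x ∈ Icc (-1 : ℝ) 1) :
    ∃ k ≤ 2 * m, x + K * (-1 + k * (1 / m) - x) ∈ Icc (-1 : ℝ) 1 := by
  have hm' : (0 : ℝ) < m := by exact_mod_cast hm
  have hmK' : 2 * (K : ℝ) ≤ m := by exact_mod_cast hmK
  obtain ⟨hx1, hx2⟩ := hx
  have hy0 : 0 ≤ (x + 1) * m := mul_nonneg (by linarith) hm'.le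
  have main : ∀ t : ℝ, |t| ≤ 1 / m → |K * t| ≤ 1 / 2 := by
    intro t ht
    rw [abs_mul, Nat.abs_cast]
    calc (K : ℝ) * |t| ≤ (m / 2) * (1 / m) := by gcongr; linarith
      _ = 1 / 2 := by field_simp
  rcases le_total x 0 with h | h
  · refine ⟨⌈(x + 1) * m⌉₊, ?_, ?_⟩
    · refine Nat.ceil_le.2 ?_
      push_cast
      nlinarith
    · have h1 := Nat.le_ceil ((x + 1) * m)
      have h2 := (Nat.ceil_lt_add_one hy0).le
      set k : ℝ := (⌈(x + 1) * m⌉₊ : ℝ)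
      have ht0 : 0 ≤ -1 + k * (1 / m) - x := by
        have : x + 1 ≤ k * (1 / m) := by rw [mul_one_div, le_div_iff₀ hm']; exact h1
        linarith
      have ht1 : -1 + k * (1 / m) - x ≤ 1 / m := by
        have : k * (1 / m) ≤ x + 1 + 1 / m := by
          rw [mul_one_div, div_le_iff₀ hm', add_mul _ (1 / (m : ℝ)), one_div,
            inv_mul_cancel₀ hm'.ne']; exact h2
        linarith
      have h3 := (abs_le.1 (main _ (abs_le.2 ⟨by linarith [one_div_pos.2 hm'], ht1⟩))).2
      constructor
      · have : (0 : ℝ) ≤ K * (-1 + k * (1 / m) - x) := by positivity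
        linarith
      · linarith
  · refine ⟨⌊(x + 1) * m⌋₊, ?_, ?_⟩
    · have h1 := Nat.floor_le hy0
      have : (⌊(x + 1) * m⌋₊ : ℝ) ≤ ((2 * m : ℕ) : ℝ) := by
        push_cast
        nlinarith
      exact_mod_cast this
    · have h1 := Nat.floor_le hy0
      have h2 := (Nat.lt_floor_add_one ((x + 1) * m)).le
      set k : ℝ := (⌊(x + 1) * m⌋₊ : ℝ)
      have ht0 : -1 + k * (1 / m) - x ≤ 0 := by
        have : k * (1 / m) ≤ x + 1 := by rw [mul_one_div, div_le_iff₀ hm']; exact h1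
        linarith
      have ht1 : -(1 / m) ≤ -1 + k * (1 / m) - x := by
        have : x + 1 ≤ k * (1 / m) + 1 / m := by
          rw [← add_one_mul, mul_one_div, le_div_iff₀ hm']; exact h2
        linarith
      have h3 := (abs_le.1 (main _ (abs_le.2 ⟨ht1, by linarith [one_div_pos.2 hm']⟩))).1
      constructor
      · linarith
      · have : (K : ℝ) * (-1 + k * (1 / m) - x) ≤ 0 :=
          mul_nonpos_of_nonneg_of_nonpos (by positivity) ht0
        linarith

/-- A bounded function on `[-1, 1]` which vanishes at `l` equidistant nodes is controlled by its
differences of order `l`. -/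
theorem exists_abs_le_of_vanishing_nodes {l : ℕ} (hl : 0 < l) :
    ∃ C : ℝ, 0 ≤ C ∧ ∀ (g : ℝ → ℝ) (δ : ℝ), (∃ M, ∀ x ∈ Icc (-1 : ℝ) 1, |g x| ≤ M) →
      (∀ x h, x ∈ Icc (-1 : ℝ) 1 → x + l * h ∈ Icc (-1 : ℝ) 1 → |(fwdDiff h)^[l] g x| ≤ δ) →
      (∀ i < l, g (-1 + 2 * i / l) = 0) → ∀ x ∈ Icc (-1 : ℝ) 1, |g x| ≤ C * δ := by
  obtain ⟨K, hK, hKp⟩ := exists_step_abs_sub_le hl (η := 1 / 4) (by norm_num)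
  have hN : 0 < 4 * K := by positivity
  obtain ⟨D, hD, hDp⟩ := exists_abs_eval_le_of_nodes l hN
  set n := K * l with hn
  set m := l * (4 * K) with hm
  have hl' : (0 : ℝ) < l := by exact_mod_cast hl
  have hK' : (0 : ℝ) < K := by exact_mod_cast hK
  refine ⟨2 * (9 / 4 * (n : ℝ) ^ l + (1 + D) * (m : ℝ) ^ l), by positivity, ?_⟩
  intro g δ hbdd hg hnode
  have hδ : 0 ≤ δ := (abs_nonneg _).trans (hg 0 0 (by simp) (by simp))
  have hconv : Convex ℝ (Icc (-1 : ℝ) 1) := convex_Icc _ _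
  have hm2 : (m : ℝ) = l * (4 * K) := by rw [hm]; push_cast; ring
  have hgrid : ∀ k ≤ m, |g (-1 + k * (2 / m))| ≤ (1 + D) * ((m : ℝ) ^ l * δ) := by
    intro k hk
    obtain ⟨p, hp, hpk⟩ := exists_polynomial_near_progression (n := m) hδ hconv g hg
      (x := -1) (h := 2 / m) (by simp) (by
        rw [mul_div_cancel₀ _ (by rw [hm2]; positivity)]; norm_num)
    have hnodes : ∀ i < l, |p.eval ((4 * K * i : ℕ) : ℝ)| ≤ (m : ℝ) ^ l * δ := by
      intro i hi
      have h1 := (hpk (4 * K * i) (by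
        rw [hm, mul_comm l]; exact Nat.mul_le_mul_left _ hi.le)).2
      have h2 : (-1 : ℝ) + ((4 * K * i : ℕ) : ℝ) * (2 / m) = -1 + 2 * i / l := by
        rw [hm2]; push_cast; field_simp
      rwa [h2, hnode i hi, zero_sub, abs_neg] at h1
    have h3 := hDp p _ hp hnodes k hk
    have h4 := (hpk k hk).2
    have h5 := abs_add_le (g (-1 + k * (2 / m)) - p.eval (k : ℝ)) (p.eval (k : ℝ))
    rw [sub_add_cancel] at h5
    linarith
  have hstep : ∀ M, (∀ x ∈ Icc (-1 : ℝ) 1, |g x| ≤ M) → ∀ x ∈ Icc (-1 : ℝ) 1,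
      |g x| ≤ M / 4 + (9 / 4 * (n : ℝ) ^ l + (1 + D) * (m : ℝ) ^ l) * δ := by
    intro M hM x hx
    obtain ⟨k, hk, hxk⟩ := exists_grid_point_near (m := 2 * n) (K := n) (by positivity) le_rfl hx
    have hmn : m = 2 * (2 * n) := by rw [hm, hn]; ring
    have hq : (-1 : ℝ) + k * (1 / ((2 * n : ℕ) : ℝ)) = -1 + k * (2 / m) := by
      rw [hmn]; push_cast; ring
    rw [hq] at hxk
    set h := -1 + k * (2 / (m : ℝ)) - x with hh
    obtain ⟨p, hp, hpk⟩ := exists_polynomial_near_progression (n := n) hδ hconv g hg hx hxk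
    have h0 := (hpk 0 (by omega)).2
    have h1 := (hpk 1 (by have : 0 < n := by positivity
                          omega)).2
    have h2 := hKp p (M + (n : ℝ) ^ l * δ) hp (fun i hi => by
      obtain ⟨hin, hle⟩ := hpk (K * i) (Nat.mul_le_mul_left _ hi.le)
      have := hM _ hin
      have h5 := abs_sub_abs_le_abs_sub (p.eval ((K * i : ℕ) : ℝ)) (g (x + ((K * i : ℕ) : ℝ) * h))
      rw [abs_sub_comm] at h5
      linarith)
    have h3 := hgrid k (by omega)
    have hxh : x + 1 * h = -1 + k * (2 / (m : ℝ)) := by rw [hh]; ring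
    simp only [Nat.cast_zero, Nat.cast_one, zero_mul, add_zero, hxh] at h0 h1
    rw [abs_le] at *
    constructor <;> linarith [h0.1, h0.2, h1.1, h1.2, h2.1, h2.2, h3.1, h3.2]
  obtain ⟨M, hM⟩ := hbdd
  have hB : BddAbove ((fun x => |g x|) '' Icc (-1 : ℝ) 1) :=
    ⟨M, by rintro _ ⟨x, hx, rfl⟩; exact hM x hx⟩
  have hS : ∀ x ∈ Icc (-1 : ℝ) 1, |g x| ≤ sSup ((fun x => |g x|) '' Icc (-1 : ℝ) 1) :=
    fun x hx => le_csSup hB ⟨x, hx, rfl⟩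
  have hS2 : sSup ((fun x => |g x|) '' Icc (-1 : ℝ) 1) ≤ _ :=
    csSup_le ⟨_, 0, by simp, rfl⟩ (by rintro _ ⟨x, hx, rfl⟩; exact hstep _ hS x hx)
  intro x hx
  have h1 := hS x hx
  have h2 : 0 ≤ (9 / 4 * (n : ℝ) ^ l + (1 + D) * (m : ℝ) ^ l) * δ := by positivity
  linarith

/-- Whitney's inequality on `[-1, 1]`, with an explicit linear approximation operator. -/
theorem exists_whitney_interval {l : ℕ} (hl : 0 < l) :
    ∃ (C : ℝ) (B : Fin l → Fin l → ℝ) (ν : Fin l → ℝ), 0 ≤ C ∧ (∀ i, ν i ∈ Icc (-1 : ℝ) 1) ∧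
      ∀ (g : ℝ → ℝ) (δ : ℝ), (∃ M, ∀ x ∈ Icc (-1 : ℝ) 1, |g x| ≤ M) →
      (∀ x h, x ∈ Icc (-1 : ℝ) 1 → x + l * h ∈ Icc (-1 : ℝ) 1 → |(fwdDiff h)^[l] g x| ≤ δ) →
      ∀ x ∈ Icc (-1 : ℝ) 1, |g x - ∑ k, (∑ i, B k i * g (ν i)) * x ^ (k : ℕ)| ≤ C * δ := by
  obtain ⟨C, hC, hCp⟩ := exists_abs_le_of_vanishing_nodes hl
  have hl' : (0 : ℝ) < l := by exact_mod_cast hl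
  let ν : Fin l → ℝ := fun i => -1 + 2 * (i : ℝ) / l
  have hν : Set.InjOn ν (Finset.univ : Finset (Fin l)) := by
    intro i _ j _ h
    simp only [ν, add_right_inj] at h
    rw [div_left_inj' hl'.ne'] at h
    exact Fin.ext (by exact_mod_cast mul_left_cancel₀ two_ne_zero h)
  refine ⟨C, fun k i => (Lagrange.basis Finset.univ ν i).coeff k, ν, hC, fun i => ?_, ?_⟩
  · have h1 : (i : ℝ) ≤ l := by exact_mod_cast i.2.le
    have h2 : 2 * (i : ℝ) / l ≤ 2 := by rw [div_le_iff₀ hl']; linarith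
    have h3 : 0 ≤ 2 * (i : ℝ) / l := by positivity
    exact ⟨by simp only [ν]; linarith, by simp only [ν]; linarith⟩
  intro g δ hbdd hg x hx
  let p := Lagrange.interpolate Finset.univ ν (fun j => g (ν j))
  have hp : p.degree < l := by
    have := Lagrange.degree_interpolate_lt (fun j => g (ν j)) hν
    rwa [Finset.card_univ, Fintype.card_fin] at this
  have hpe : ∀ x, p.eval x =
      ∑ k : Fin l, (∑ i, (Lagrange.basis Finset.univ ν i).coeff k * g (ν i)) * x ^ (k : ℕ) := by
    intro x
    rw [Polynomial.eval_eq_sum_range' (Polynomial.natDegree_lt_of_degree_lt_cast hl hp),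
      Finset.sum_range]
    refine Finset.sum_congr rfl fun k _ => ?_
    simp [p, Lagrange.interpolate_apply, Polynomial.finsetSum_coeff, mul_comm]
  rw [← hpe]
  refine hCp (fun x => g x - p.eval x) δ ?_ ?_ ?_ x hx
  · obtain ⟨M, hM⟩ := hbdd
    obtain ⟨M', hM'⟩ := (isCompact_Icc (a := (-1 : ℝ)) (b := 1)).exists_bound_of_continuousOn
      (f := fun x => p.eval x) (by fun_prop)
    exact ⟨M + M', fun x hx => (abs_sub _ _).trans (add_le_add (hM x hx) (hM' x hx))⟩
  · intro x h h1 h2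
    rw [fwdDiff_iter_sub, Polynomial.fwdDiff_iter_eval_eq_zero hp, sub_zero]
    exact hg x h h1 h2
  · intro i hi
    have := Lagrange.eval_interpolate_at_node (fun j => g (ν j)) hν (Finset.mem_univ ⟨i, hi⟩)
    exact sub_eq_zero.2 this.symm

/-- The polynomial of degree less than `l` in each of `d` variables with coefficients `c`. -/
def boxPoly {d l : ℕ} (c : (Fin d → Fin l) → ℝ) : MvPolynomial (Fin d) ℝ :=
  ∑ m, MvPolynomial.monomial (Finsupp.equivFunOnFinite.symm fun i => (m i : ℕ)) (c m)

theorem eval_boxPoly {d l : ℕ} (c : (Fin d → Fin l) → ℝ) (u : Fin d → ℝ) :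
    MvPolynomial.eval u (boxPoly c) = ∑ m, c m * ∏ i, u i ^ (m i : ℕ) := by
  simp [boxPoly, MvPolynomial.eval_monomial, Finsupp.prod_fintype]

theorem coeff_boxPoly {d l : ℕ} (c : (Fin d → Fin l) → ℝ) (m : Fin d → Fin l) :
    (boxPoly c).coeff (Finsupp.equivFunOnFinite.symm fun i => (m i : ℕ)) = c m := by
  classical
  rw [boxPoly, MvPolynomial.coeff_sum, Finset.sum_eq_single m]
  · simp
  · intro m' _ hne
    rw [MvPolynomial.coeff_monomial, if_neg]
    intro h
    apply hne
    funext i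
    have := congrFun (Finsupp.equivFunOnFinite.symm.injective h) i
    exact Fin.ext this
  · simp

theorem norm_cons_le_one_iff {d : ℕ} (t : ℝ) (u : Fin d → ℝ) :
    ‖(Fin.cons t u : Fin (d + 1) → ℝ)‖ ≤ 1 ↔ t ∈ Icc (-1 : ℝ) 1 ∧ ‖u‖ ≤ 1 := by
  rw [pi_norm_le_iff_of_nonneg zero_le_one, pi_norm_le_iff_of_nonneg zero_le_one,
    Fin.forall_fin_succ]
  simp [abs_le]

/-- Whitney's inequality on the cube `[-1, 1]^d`, for polynomials of degree less than `l` in each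
variable. -/
theorem exists_whitney_cube {l : ℕ} (hl : 0 < l) (d : ℕ) :
    ∃ C : ℝ, 0 ≤ C ∧ ∀ (F : (Fin d → ℝ) → ℝ) (δ : ℝ), (∃ M, ∀ u, ‖u‖ ≤ 1 → |F u| ≤ M) →
      (∀ u h, ‖u‖ ≤ 1 → ‖u + (l : ℝ) • h‖ ≤ 1 → |(fwdDiff h)^[l] F u| ≤ δ) →
      ∃ c : (Fin d → Fin l) → ℝ, ∀ u, ‖u‖ ≤ 1 →
        |F u - MvPolynomial.eval u (boxPoly c)| ≤ C * δ := by
  induction d with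
  | zero =>
    refine ⟨0, le_rfl, fun F δ _ _ => ⟨fun _ => F 0, fun u _ => ?_⟩⟩
    rw [eval_boxPoly, Subsingleton.elim u 0]
    simp
  | succ d ih =>
    obtain ⟨C₁, B, ν, hC₁, hν, hW⟩ := exists_whitney_interval hl
    obtain ⟨C, hC, ihC⟩ := ih
    refine ⟨C₁ + (∑ k, ∑ i, |B k i|) * C, by positivity, fun F δ hbdd hF => ?_⟩
    obtain ⟨M, hM⟩ := hbdd
    have hδ : 0 ≤ δ := (abs_nonneg _).trans (hF 0 0 (by simp) (by simp))
    have hslice : ∀ i, ∃ c : (Fin d → Fin l) → ℝ, ∀ u, ‖u‖ ≤ 1 →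
        |F (Fin.cons (ν i) u) - MvPolynomial.eval u (boxPoly c)| ≤ C * δ := by
      intro i
      refine ihC (fun u => F (Fin.cons (ν i) u)) δ
        ⟨M, fun u hu => hM _ ((norm_cons_le_one_iff _ _).2 ⟨hν i, hu⟩)⟩ fun u h hu huh => ?_
      rw [fwdDiff_iter_comp F (fun u => (Fin.cons (ν i) u : Fin (d + 1) → ℝ)) h (Fin.cons 0 h)
        (fun y => by funext j; refine Fin.cases ?_ (fun j => ?_) j <;> simp)]
      refine hF _ _ ((norm_cons_le_one_iff _ _).2 ⟨hν i, hu⟩) ?_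
      have : (Fin.cons (ν i) u : Fin (d + 1) → ℝ) + (l : ℝ) • (Fin.cons 0 h : Fin (d + 1) → ℝ)
          = Fin.cons (ν i) (u + (l : ℝ) • h) := by
        funext j; refine Fin.cases ?_ (fun j => ?_) j <;> simp
      rw [this]
      exact (norm_cons_le_one_iff _ _).2 ⟨hν i, huh⟩
    choose c hc using hslice
    refine ⟨fun m => ∑ i, B (m 0) i * c i (Fin.tail m), fun w hw => ?_⟩
    obtain ⟨t, u, rfl⟩ : ∃ t u, w = Fin.cons t u := ⟨w 0, Fin.tail w, (Fin.cons_self_tail w).symm⟩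
    obtain ⟨ht, hu⟩ := (norm_cons_le_one_iff _ _).1 hw
    have h1 := hW (fun t => F (Fin.cons t u)) δ
      ⟨M, fun t ht => hM _ ((norm_cons_le_one_iff _ _).2 ⟨ht, hu⟩)⟩ (fun t h ht hth => by
        rw [fwdDiff_iter_comp F (fun t => (Fin.cons t u : Fin (d + 1) → ℝ)) h (Fin.cons h 0)
          (fun y => by funext j; refine Fin.cases ?_ (fun j => ?_) j <;> simp)]
        refine hF _ _ ((norm_cons_le_one_iff _ _).2 ⟨ht, hu⟩) ?_
        have : (Fin.cons t u : Fin (d + 1) → ℝ) + (l : ℝ) • (Fin.cons h 0 : Fin (d + 1) → ℝ)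
            = Fin.cons (t + l * h) u := by
          funext j; refine Fin.cases ?_ (fun j => ?_) j <;> simp
        rw [this]
        exact (norm_cons_le_one_iff _ _).2 ⟨hth, hu⟩) t ht
    have h2 : MvPolynomial.eval (Fin.cons t u : Fin (d + 1) → ℝ)
        (boxPoly fun m : Fin (d + 1) → Fin l => ∑ i, B (m 0) i * c i (Fin.tail m)) =
        ∑ k, (∑ i, B k i * MvPolynomial.eval u (boxPoly (c i))) * t ^ (k : ℕ) := by
      rw [eval_boxPoly, ← (Fin.consEquiv fun _ => Fin l).sum_comp, Fintype.sum_prod_type]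
      refine Finset.sum_congr rfl fun k _ => ?_
      simp only [eval_boxPoly, Fin.consEquiv_apply, Fin.prod_univ_succ, Fin.cons_zero,
        Fin.cons_succ, Finset.sum_mul, Finset.mul_sum]
      rw [Finset.sum_comm]
      refine Finset.sum_congr rfl fun i _ => Finset.sum_congr rfl fun m _ => ?_
      have htail : Fin.tail ((Fin.consEquiv fun _ => Fin l) (k, m)) = m := rfl
      rw [htail]
      ring
    have h3 : |∑ k, (∑ i, B k i * F (Fin.cons (ν i) u)) * t ^ (k : ℕ) -
        ∑ k, (∑ i, B k i * MvPolynomial.eval u (boxPoly (c i))) * t ^ (k : ℕ)| ≤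
        (∑ k, ∑ i, |B k i|) * (C * δ) := by
      rw [← Finset.sum_sub_distrib, Finset.sum_mul]
      refine (Finset.abs_sum_le_sum_abs _ _).trans (Finset.sum_le_sum fun k _ => ?_)
      rw [← sub_mul, ← Finset.sum_sub_distrib, abs_mul, abs_pow]
      have hsum : |∑ i, (B k i * F (Fin.cons (ν i) u) -
          B k i * MvPolynomial.eval u (boxPoly (c i)))| ≤ (∑ i, |B k i|) * (C * δ) := by
        rw [Finset.sum_mul]
        refine (Finset.abs_sum_le_sum_abs _ _).trans (Finset.sum_le_sum fun i _ => ?_)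
        rw [← mul_sub, abs_mul]
        exact mul_le_mul_of_nonneg_left (hc i u hu) (abs_nonneg _)
      exact (mul_le_of_le_one_right (abs_nonneg _)
        (pow_le_one₀ (abs_nonneg _) (abs_le.2 ht))).trans hsum
    rw [h2]
    calc _ ≤ _ := abs_sub_le _ _ _
      _ ≤ C₁ * δ + (∑ k, ∑ i, |B k i|) * (C * δ) := add_le_add h1 h3
      _ = _ := by ring

theorem exists_abs_coeff_le (d l : ℕ) :
    ∃ K : ℝ, 0 ≤ K ∧ ∀ (c : (Fin d → Fin l) → ℝ) (A : ℝ),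
      (∀ u, ‖u‖ ≤ 1 → |MvPolynomial.eval u (boxPoly c)| ≤ A) → ∀ m, |c m| ≤ K * A := by
  let T : ((Fin d → Fin l) → ℝ) →ₗ[ℝ] C(Metric.closedBall (0 : Fin d → ℝ) 1, ℝ) :=
    { toFun := fun c => ⟨fun u => MvPolynomial.eval u (boxPoly c),
        Continuous.comp (g := fun u : Fin d → ℝ => MvPolynomial.eval u (boxPoly c))
          (MvPolynomial.continuous_eval _) continuous_subtype_val⟩
      map_add' := fun c c' => by
        ext u
        simp [eval_boxPoly, add_mul, Finset.sum_add_distrib]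
      map_smul' := fun a c => by
        ext u
        simp [eval_boxPoly, Finset.mul_sum, mul_assoc] }
  have hT : Function.Injective T := by
    rw [injective_iff_map_eq_zero]
    intro c hc
    have h0 : boxPoly c = 0 := by
      refine MvPolynomial.funext_set (fun _ => Icc (-1 : ℝ) 1)
        (fun _ => Set.Icc_infinite (by norm_num)) fun u hu => ?_
      have hu' : u ∈ Metric.closedBall (0 : Fin d → ℝ) 1 := by
        rw [mem_closedBall_zero_iff, pi_norm_le_iff_of_nonneg zero_le_one]
        exact fun i => abs_le.2 (hu i trivial)
      have h1 : T c ⟨u, hu'⟩ = 0 := by rw [hc]; rfl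
      rw [map_zero]
      exact h1
    funext m
    rw [← coeff_boxPoly c m, h0]
    simp
  obtain ⟨K, -, hK⟩ := T.injective_iff_antilipschitz.1 hT
  refine ⟨K, K.2, fun c A hA m => ?_⟩
  have hA0 : 0 ≤ A := (abs_nonneg _).trans (hA 0 (by simp))
  have h1 : ‖T c‖ ≤ A := (ContinuousMap.norm_le _ hA0).2 fun u =>
    hA u (mem_closedBall_zero_iff.1 u.2)
  have h2 : ‖c‖ ≤ K * ‖T c‖ := by
    simpa [dist_zero_right] using hK.le_mul_dist c 0
  exact (norm_le_pi_norm c m).trans (h2.trans (by gcongr))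

theorem exists_abs_coeff_mul_pow_le (d l : ℕ) :
    ∃ K : ℝ, 0 ≤ K ∧ ∀ (c : (Fin d → Fin l) → ℝ) (A r : ℝ), 0 ≤ r →
      (∀ y, ‖y‖ ≤ r → |MvPolynomial.eval y (boxPoly c)| ≤ A) →
      ∀ m, |c m| * r ^ (∑ i, (m i : ℕ)) ≤ K * A := by
  obtain ⟨K, hK, h⟩ := exists_abs_coeff_le d l
  refine ⟨K, hK, fun c A r hr hA m => ?_⟩
  have := h (fun m => c m * r ^ (∑ i, (m i : ℕ))) A (fun u hu => by
    have h1 := hA (r • u) (by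
      rw [norm_smul, Real.norm_of_nonneg hr]; exact mul_le_of_le_one_right hr hu)
    convert h1 using 2
    simp only [eval_boxPoly, Pi.smul_apply, smul_eq_mul, mul_pow, Finset.prod_mul_distrib,
      Finset.prod_pow_eq_pow_sum, mul_assoc]) m
  rwa [abs_mul, abs_of_nonneg (pow_nonneg hr _)] at this

/-- A sequence whose increments are bounded by a geometric sequence of ratio `ρ ≠ 1` is, up to
that geometric sequence, constant if `ρ < 1` and zero if `ρ > 1`. -/
theorem exists_abs_sub_le_geometric {s : ℕ → ℝ} {B ρ : ℝ} (hρ : 0 < ρ) (hρ1 : ρ ≠ 1)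
    (hs : ∀ n, |s n - s (n + 1)| ≤ B * ρ ^ n) :
    ∃ a A : ℝ, 0 ≤ A ∧ (1 < ρ → a = 0) ∧ ∀ n, |s n - a| ≤ A * ρ ^ n := by
  have hd : ∀ n, dist (s n) (s (n + 1)) ≤ B * ρ ^ n := hs
  have hB : 0 ≤ B := by simpa using (abs_nonneg _).trans (hs 0)
  rcases lt_or_gt_of_ne hρ1 with h | h
  · obtain ⟨a, ha⟩ := cauchySeq_tendsto_of_complete (cauchySeq_of_le_geometric ρ B h hd)
    refine ⟨a, B / (1 - ρ), div_nonneg hB (by linarith), fun h' => absurd h' (by linarith),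
      fun n => ?_⟩
    have := dist_le_of_le_geometric_of_tendsto ρ B h hd ha n
    rw [Real.dist_eq] at this
    rwa [div_mul_eq_mul_div]
  · have h1 : 0 < ρ - 1 := by linarith
    refine ⟨0, |s 0| + B / (ρ - 1), by positivity, fun _ => rfl, fun n => ?_⟩
    rw [sub_zero]
    induction n with
    | zero => simp only [pow_zero, mul_one]; linarith [div_nonneg hB h1.le]
    | succ n ih =>
      have h2 : |s (n + 1)| ≤ |s n| + B * ρ ^ n := by
        have h3 := abs_sub_abs_le_abs_sub (s (n + 1)) (s n)
        rw [abs_sub_comm] at h3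
        linarith [hs n]
      have hpn : 0 < ρ ^ n := by positivity
      calc |s (n + 1)| ≤ (|s 0| + B / (ρ - 1)) * ρ ^ n + B * ρ ^ n := by linarith
        _ = |s 0| * ρ ^ n + B / (ρ - 1) * ρ ^ (n + 1) := by
          rw [pow_succ]; field_simp; ring
        _ ≤ |s 0| * ρ ^ (n + 1) + B / (ρ - 1) * ρ ^ (n + 1) := by
          gcongr
          · exact h.le
          · omega
        _ = _ := by ring

/-- If near `x₀` a function is approximated to order `α`, at every dyadic scale, by some polynomial
of uniformly bounded degree, then it is pointwise Hölder of order `α` at `x₀`. -/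
theorem holderAt_of_approx_at_scales {d l : ℕ} {f : (Fin d → ℝ) → ℝ} {x₀ : Fin d → ℝ} {α : ℝ}
    (hα : 0 < α) (hαn : ∀ n : ℕ, (n : ℝ) ≠ α) {C : ℝ} (J : ℕ)
    (h : ∀ n : ℕ, ∃ c : (Fin d → Fin l) → ℝ, ∀ y, ‖y‖ ≤ (1 / 2 : ℝ) ^ (J + n) →
      |f (x₀ + y) - MvPolynomial.eval y (boxPoly c)| ≤ C * ((1 / 2 : ℝ) ^ α) ^ n) :
    HolderAt f x₀ α := by
  choose c hc using h
  set θ : ℝ := (1 / 2 : ℝ) ^ α with hθ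
  have hθ0 : 0 < θ := by positivity
  have hθ1 : θ < 1 := Real.rpow_lt_one (by norm_num) (by norm_num) hα
  have hC : 0 ≤ C := by simpa using (abs_nonneg _).trans (hc 0 0 (by simp))
  obtain ⟨K, hK, hKc⟩ := exists_abs_coeff_mul_pow_le d l
  have hρ : ∀ N : ℕ, 2 ^ N * θ = (2 : ℝ) ^ ((N : ℝ) - α) := by
    intro N
    rw [hθ, Real.rpow_sub two_pos, Real.rpow_natCast, one_div, Real.inv_rpow two_pos.le,
      div_eq_mul_inv]
  have hincr : ∀ m : Fin d → Fin l, ∀ n, |c n m - c (n + 1) m| ≤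
      (2 * K * C * 2 ^ ((J + 1) * ∑ i, (m i : ℕ))) * (2 ^ (∑ i, (m i : ℕ)) * θ) ^ n := by
    intro m n
    have h1 := hKc (fun m => c n m - c (n + 1) m) (2 * C * θ ^ n) ((1 / 2) ^ (J + (n + 1)))
      (by positivity) (fun y hy => by
        have e1 := hc n y (hy.trans
          (pow_le_pow_of_le_one (by norm_num) (by norm_num) (by omega)))
        have e2 := hc (n + 1) y hy
        have e3 : C * θ ^ (n + 1) ≤ C * θ ^ n := by
          gcongr ?_ * ?_
          exact pow_le_pow_of_le_one hθ0.le hθ1.le (by omega)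
        have e4 : MvPolynomial.eval y (boxPoly fun m => c n m - c (n + 1) m) =
            MvPolynomial.eval y (boxPoly (c n)) - MvPolynomial.eval y (boxPoly (c (n + 1))) := by
          simp [eval_boxPoly, sub_mul]
        rw [e4]
        rw [abs_le] at *
        constructor <;> linarith [e1.1, e1.2, e2.1, e2.2]) m
    set N := ∑ i, (m i : ℕ)
    have h2 : (0 : ℝ) < ((1 / 2) ^ (J + (n + 1))) ^ N := by positivity
    rw [← le_div_iff₀ h2] at h1
    refine h1.trans (le_of_eq ?_)
    rw [mul_pow, ← pow_mul, ← pow_mul, one_div, inv_pow, div_inv_eq_mul,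
      show (J + (n + 1)) * N = (J + 1) * N + N * n by ring, pow_add]
    ring
  have hlim : ∀ m : Fin d → Fin l, ∃ a A : ℝ, 0 ≤ A ∧ (α < ((∑ i, (m i : ℕ) : ℕ) : ℝ) → a = 0) ∧
      ∀ n, |c n m - a| ≤ A * (2 ^ (∑ i, (m i : ℕ)) * θ) ^ n := by
    intro m
    obtain ⟨a, A, hA, ha, hn⟩ := exists_abs_sub_le_geometric (by positivity) (by
      rw [hρ]
      intro h
      rcases lt_or_gt_of_ne (sub_ne_zero.2 (hαn (∑ i, (m i : ℕ)))) with h' | h'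
      · exact (Real.rpow_lt_one_of_one_lt_of_neg one_lt_two h').ne h
      · exact (Real.one_lt_rpow one_lt_two h').ne' h) (hincr m)
    refine ⟨a, A, hA, fun h => ha ?_, hn⟩
    rw [hρ]
    exact Real.one_lt_rpow one_lt_two (by linarith)
  choose a A hA ha hca using hlim
  set E := C + ∑ m, A m with hE
  have hE0 : 0 ≤ E := add_nonneg hC (Finset.sum_nonneg fun m _ => hA m)
  have happrox : ∀ n : ℕ, ∀ y, ‖y‖ ≤ (1 / 2 : ℝ) ^ (J + n) →
      |f (x₀ + y) - MvPolynomial.eval y (boxPoly a)| ≤ E * θ ^ n := by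
    intro n y hy
    have h1 : |MvPolynomial.eval y (boxPoly (c n)) - MvPolynomial.eval y (boxPoly a)| ≤
        (∑ m, A m) * θ ^ n := by
      rw [eval_boxPoly, eval_boxPoly, ← Finset.sum_sub_distrib, Finset.sum_mul]
      refine (Finset.abs_sum_le_sum_abs _ _).trans (Finset.sum_le_sum fun m _ => ?_)
      rw [← sub_mul, abs_mul]
      set N := ∑ i, (m i : ℕ)
      have h2 : |∏ i, y i ^ (m i : ℕ)| ≤ ((1 / 2 : ℝ) ^ n) ^ N := by
        rw [Finset.abs_prod, ← Finset.prod_pow_eq_pow_sum]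
        refine Finset.prod_le_prod (fun _ _ => abs_nonneg _) fun i _ => ?_
        rw [abs_pow]
        refine pow_le_pow_left₀ (abs_nonneg _) ((norm_le_pi_norm y i).trans (hy.trans ?_)) _
        exact pow_le_pow_of_le_one (by norm_num) (by norm_num) (by omega)
      calc |c n m - a m| * |∏ i, y i ^ (m i : ℕ)|
          ≤ (A m * (2 ^ N * θ) ^ n) * ((1 / 2 : ℝ) ^ n) ^ N := by
            gcongr
            · exact mul_nonneg (hA m) (by positivity)
            · exact hca m n
        _ = A m * θ ^ n * ((2 ^ N) ^ n * ((1 / 2 : ℝ) ^ n) ^ N) := by rw [mul_pow]; ring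
        _ = A m * θ ^ n := by
            rw [← pow_mul, ← pow_mul, mul_comm n N, ← mul_pow]
            norm_num
    calc _ ≤ _ := abs_sub_le _ (MvPolynomial.eval y (boxPoly (c n))) _
      _ ≤ C * θ ^ n + (∑ m, A m) * θ ^ n := add_le_add (hc n y hy) h1
      _ = _ := by rw [hE]; ring
  set R : ℝ := (1 / 2 : ℝ) ^ J with hR
  have hR0 : 0 < R := by positivity
  refine ⟨E / (R ^ α * θ) + 1, R, by positivity, hR0, boxPoly a, ?_, fun x hx => ?_⟩
  · have hdeg : (boxPoly a).totalDegree ≤ ⌊α⌋₊ := by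
      refine MvPolynomial.totalDegree_finsetSum_le fun m _ => ?_
      by_cases hm : α < ((∑ i, (m i : ℕ) : ℕ) : ℝ)
      · simp [ha m hm]
      · refine (MvPolynomial.totalDegree_monomial_le _ _).trans (Nat.le_floor ?_)
        rw [Finsupp.sum_fintype _ _ (fun _ => rfl)]
        simpa using hm
    exact (Nat.cast_le.2 hdeg).trans (Nat.floor_le hα.le)
  · obtain ⟨y, rfl⟩ : ∃ y, x = x₀ + y := ⟨x - x₀, by abel⟩
    have hy : (fun i => (x₀ + y) i - x₀ i) = y := by funext i; simp
    rw [add_sub_cancel_left] at hx ⊢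
    rw [hy]
    rcases eq_or_ne y 0 with rfl | hy0
    · have hle : |f (x₀ + 0) - MvPolynomial.eval 0 (boxPoly a)| ≤ 0 := by
        refine ge_of_tendsto' (f := fun n : ℕ => E * θ ^ n) (x := atTop) ?_
          fun n => happrox n 0 (by simp)
        simpa using (tendsto_pow_atTop_nhds_zero_of_lt_one hθ0.le hθ1).const_mul E
      rw [norm_zero, Real.zero_rpow hα.ne', mul_zero]
      exact hle
    · have hyn : 0 < ‖y‖ := norm_pos_iff.2 hy0
      obtain ⟨n, hn1, hn2⟩ := exists_nat_pow_near_of_lt_one (div_pos hyn hR0)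
        ((div_le_one hR0).2 hx) (by norm_num : (0 : ℝ) < 1 / 2) (by norm_num)
      have h1 := happrox n y (by
        rw [pow_add, mul_comm]; exact (div_le_iff₀ hR0).1 hn2)
      have h2 : θ ^ (n + 1) ≤ ‖y‖ ^ α / R ^ α := by
        rw [← Real.div_rpow hyn.le hR0.le, hθ, ← Real.rpow_natCast, ← Real.rpow_mul (by norm_num),
          mul_comm α, Real.rpow_mul (by norm_num), Real.rpow_natCast]
        exact Real.rpow_le_rpow (by positivity) hn1.le hα.le
      calc _ ≤ E * θ ^ n := h1
        _ = E / θ * θ ^ (n + 1) := by rw [pow_succ]; field_simp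
        _ ≤ E / θ * (‖y‖ ^ α / R ^ α) := by gcongr
        _ = E / (R ^ α * θ) * ‖y‖ ^ α := by field_simp
        _ ≤ _ := by gcongr; linarith

theorem iteratedDiff_eq_fwdDiff_iter {d : ℕ} (f : (Fin d → ℝ) → ℝ) (l : ℕ) (h x : Fin d → ℝ) :
    iteratedDiff f l h x = (fwdDiff h)^[l] f x := by
  induction l generalizing x with
  | zero => rfl
  | succ l ih => rw [Function.iterate_succ_apply', fwdDiff, iteratedDiff, ih, ih]

theorem MvPolynomial.fwdDiff_iter_eval_eq_zero {d l : ℕ} {P : MvPolynomial (Fin d) ℝ}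
    (hP : P.totalDegree < l) (x₀ h x : Fin d → ℝ) :
    (fwdDiff h)^[l] (fun x => MvPolynomial.eval (fun i => x i - x₀ i) P) x = 0 := by
  let p : Polynomial ℝ := MvPolynomial.aeval
    (fun i => Polynomial.C (x i - x₀ i) + Polynomial.C (h i) * Polynomial.X) P
  have hp : p.natDegree < l := by
    refine lt_of_le_of_lt ((MvPolynomial.aeval_natDegree_le (n := 1) P le_rfl _ fun i => ?_).trans
      (mul_one _).le) hP
    compute_degree
  have he : ∀ t, p.eval t = MvPolynomial.eval (fun i => (x + t • h) i - x₀ i) P := by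
    intro t
    change (Polynomial.evalRingHom t) (MvPolynomial.aeval _ P) = _
    rw [MvPolynomial.aeval_def, MvPolynomial.hom_eval₂, MvPolynomial.eval, MvPolynomial.coe_eval₂Hom]
    congr 1
    · ext; simp
    · funext i; simp; ring
  have h1 := fwdDiff_iter_comp (fun x => MvPolynomial.eval (fun i => x i - x₀ i) P)
    (fun t : ℝ => x + t • h) 1 h (fun t => by rw [add_smul, one_smul, add_assoc]) l 0
  simp only [← he, zero_smul, add_zero] at h1
  rw [← h1]
  exact congrFun (Polynomial.fwdDiff_iter_eq_zero_of_degree_lt hp) 0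

theorem dyadicIndex_mul_le {d : ℕ} (j : ℕ) (x : Fin d → ℝ) (i : Fin d) :
    (dyadicIndex d j x i : ℝ) * (1 / 2) ^ j ≤ x i ∧
      x i < ((dyadicIndex d j x i : ℝ) + 1) * (1 / 2) ^ j := by
  have h1 := Int.floor_le (x i * 2 ^ j)
  have h2 := Int.lt_floor_add_one (x i * 2 ^ j)
  have hj : (0 : ℝ) < 2 ^ j := by positivity
  rw [one_div, inv_pow, ← div_eq_mul_inv, ← div_eq_mul_inv]
  exact ⟨(div_le_iff₀ hj).2 h1, (lt_div_iff₀ hj).2 h2⟩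

theorem mem_threeCube_iff {d j : ℕ} {k : Fin d → ℤ} {y : Fin d → ℝ} :
    y ∈ threeCube d j k ↔
      ∀ i, ((k i : ℝ) - 1) * (1 / 2) ^ j ≤ y i ∧ y i < ((k i : ℝ) + 2) * (1 / 2) ^ j := by
  simp [threeCube]

theorem add_mem_threeCube {d j : ℕ} {x₀ y : Fin d → ℝ} (hy : ‖y‖ ≤ (1 / 2 : ℝ) ^ j) :
    x₀ + y ∈ threeCube d j (dyadicIndex d j x₀) := by
  rw [mem_threeCube_iff]
  intro i
  have h1 := dyadicIndex_mul_le j x₀ i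
  have h2 := abs_le.1 ((norm_le_pi_norm y i).trans hy)
  rw [Pi.add_apply]
  constructor <;> linarith [h1.1, h1.2, h2.1, h2.2]

theorem norm_sub_le_of_mem_threeCube {d j : ℕ} {x₀ z : Fin d → ℝ}
    (hz : z ∈ threeCube d j (dyadicIndex d j x₀)) : ‖z - x₀‖ ≤ 2 * (1 / 2 : ℝ) ^ j := by
  rw [pi_norm_le_iff_of_nonneg (by positivity)]
  intro i
  have h1 := dyadicIndex_mul_le j x₀ i
  have h2 := mem_threeCube_iff.1 hz i
  rw [Pi.sub_apply, Real.norm_eq_abs, abs_le]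
  constructor <;> linarith [h1.1, h1.2, h2.1, h2.2]

theorem convex_threeCube {d j : ℕ} {k : Fin d → ℤ} : Convex ℝ (threeCube d j k) := by
  have : threeCube d j k = Set.pi univ fun i =>
      Ico (((k i : ℝ) - 1) * 2 ^ (-(j : ℤ))) (((k i : ℝ) + 2) * 2 ^ (-(j : ℤ))) := by
    ext y; simp [threeCube]
  rw [this]
  exact convex_pi fun i _ => convex_Ico _ _

theorem oscil_nonneg {d l : ℕ} (f : (Fin d → ℝ) → ℝ) (A : Set (Fin d → ℝ)) : 0 ≤ oscil l f A :=
  Real.sSup_nonneg (by rintro _ ⟨x, h, -, -, rfl⟩; exact abs_nonneg _)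

theorem abs_fwdDiff_iter_le_oscil {d l : ℕ} {f : (Fin d → ℝ) → ℝ} {A : Set (Fin d → ℝ)}
    (hA : Convex ℝ A) {M : ℝ} (hf : ∀ x ∈ A, |f x| ≤ M) {x h : Fin d → ℝ} (hx : x ∈ A)
    (hxh : x + (l : ℝ) • h ∈ A) : |(fwdDiff h)^[l] f x| ≤ oscil l f A := by
  refine le_csSup ⟨2 ^ l * M, ?_⟩ ⟨x, h, hx, hxh, by rw [iteratedDiff_eq_fwdDiff_iter]⟩
  rintro _ ⟨x, h, hx, hxh, rfl⟩
  rw [iteratedDiff_eq_fwdDiff_iter]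
  refine abs_fwdDiff_iter_le fun k hk => hf _ ?_
  rw [← Nat.cast_smul_eq_nsmul ℝ]
  exact hA.add_natCast_smul_mem hx hxh hk

theorem HolderAt.exists_oscil_threeCube_le {d l : ℕ} {f : (Fin d → ℝ) → ℝ} {x₀ : Fin d → ℝ} {α : ℝ}
    (hα : 0 ≤ α) (hαl : α < l) (hf : HolderAt f x₀ α) :
    ∃ A : ℝ, 0 < A ∧ ∀ᶠ j : ℕ in atTop,
      oscil l f (threeCube d j (dyadicIndex d j x₀)) ≤ A * ((1 / 2 : ℝ) ^ α) ^ j := by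
  obtain ⟨C, R, hC, hR, P, hP, hfP⟩ := hf
  have hPl : P.totalDegree < l := by exact_mod_cast hP.trans_lt hαl
  refine ⟨2 ^ l * C * 2 ^ α, by positivity, ?_⟩
  have ht : Tendsto (fun j : ℕ => 2 * (1 / 2 : ℝ) ^ j) atTop (𝓝 0) := by
    simpa using (tendsto_pow_atTop_nhds_zero_of_lt_one (r := (1 / 2 : ℝ)) (by norm_num)
      (by norm_num)).const_mul 2
  filter_upwards [ht.eventually (ge_mem_nhds hR)] with j hj
  refine Real.sSup_le ?_ (by positivity)
  rintro _ ⟨x, h, hx, hxh, rfl⟩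
  have h1 := fwdDiff_iter_sub f (fun x => MvPolynomial.eval (fun i => x i - x₀ i) P) h l x
  rw [MvPolynomial.fwdDiff_iter_eval_eq_zero hPl, sub_zero] at h1
  rw [iteratedDiff_eq_fwdDiff_iter, ← h1]
  have h2 : ((1 / 2 : ℝ) ^ α) ^ j = ((1 / 2 : ℝ) ^ j) ^ α := by
    rw [← Real.rpow_natCast, ← Real.rpow_mul (by norm_num), mul_comm,
      Real.rpow_mul (by norm_num), Real.rpow_natCast]
  rw [h2, mul_assoc, mul_assoc, ← Real.mul_rpow (by norm_num) (by positivity)]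
  refine abs_fwdDiff_iter_le fun k hk => ?_
  rw [← Nat.cast_smul_eq_nsmul ℝ]
  have h3 := norm_sub_le_of_mem_threeCube (convex_threeCube.add_natCast_smul_mem hx hxh hk)
  exact (hfP _ (h3.trans hj)).trans (by gcongr)

theorem holderAt_of_oscil_threeCube_le {d l : ℕ} (hl : 0 < l) {f : (Fin d → ℝ) → ℝ}
    {x₀ : Fin d → ℝ} {α : ℝ} (hα : 0 < α) (hαn : ∀ n : ℕ, (n : ℝ) ≠ α) {M r₀ : ℝ} (hr₀ : 0 < r₀)
    (hM : ∀ x ∈ Metric.ball x₀ r₀, |f x| ≤ M)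
    (hosc : ∀ᶠ j : ℕ in atTop,
      oscil l f (threeCube d j (dyadicIndex d j x₀)) ≤ ((1 / 2 : ℝ) ^ α) ^ j) :
    HolderAt f x₀ α := by
  obtain ⟨C, hC, hW⟩ := exists_whitney_cube hl d
  have ht : Tendsto (fun j : ℕ => 2 * (1 / 2 : ℝ) ^ j) atTop (𝓝 0) := by
    simpa using (tendsto_pow_atTop_nhds_zero_of_lt_one (r := (1 / 2 : ℝ)) (by norm_num)
      (by norm_num)).const_mul 2
  obtain ⟨J, hJ⟩ := eventually_atTop.1 (hosc.and (ht.eventually (gt_mem_nhds hr₀)))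
  refine holderAt_of_approx_at_scales (l := l) (C := C * ((1 / 2 : ℝ) ^ α) ^ J) hα hαn J
    fun n => ?_
  obtain ⟨hj1, hj2⟩ := hJ (J + n) (by omega)
  set r : ℝ := (1 / 2 : ℝ) ^ (J + n) with hr
  have hr0 : 0 < r := by positivity
  have hbd : ∀ z ∈ threeCube d (J + n) (dyadicIndex d (J + n) x₀), |f z| ≤ M := fun z hz =>
    hM z (by rw [mem_ball_iff_norm]; exact (norm_sub_le_of_mem_threeCube hz).trans_lt hj2)
  have hmem : ∀ u : Fin d → ℝ, ‖u‖ ≤ 1 →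
      x₀ + r • u ∈ threeCube d (J + n) (dyadicIndex d (J + n) x₀) := fun u hu =>
    add_mem_threeCube (by
      rw [norm_smul, Real.norm_of_nonneg hr0.le]; exact mul_le_of_le_one_right hr0.le hu)
  obtain ⟨c, hc⟩ := hW (fun u => f (x₀ + r • u)) (((1 / 2 : ℝ) ^ α) ^ (J + n))
    ⟨M, fun u hu => hbd _ (hmem u hu)⟩ (fun u h hu huh => by
      rw [fwdDiff_iter_comp f (fun u => x₀ + r • u) h (r • h)
        (fun y => by rw [smul_add, add_assoc])]
      refine (abs_fwdDiff_iter_le_oscil convex_threeCube hbd (hmem u hu) ?_).trans hj1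
      have := hmem _ huh
      rwa [smul_add, ← add_assoc, smul_comm] at this)
  refine ⟨fun m => c m * (r ^ (∑ i, (m i : ℕ)))⁻¹, fun y hy => ?_⟩
  have h1 := hc (r⁻¹ • y) (by
    rw [norm_smul, norm_inv, Real.norm_of_nonneg hr0.le]
    exact inv_mul_le_one_of_le₀ hy hr0.le)
  rw [smul_inv_smul₀ hr0.ne', pow_add, ← mul_assoc] at h1
  convert h1 using 3
  simp only [eval_boxPoly, Pi.smul_apply, smul_eq_mul, mul_pow, Finset.prod_mul_distrib,
    Finset.prod_inv_distrib, Finset.prod_pow_eq_pow_sum, mul_assoc, inv_pow]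

theorem le_holderExp {d : ℕ} {f : (Fin d → ℝ) → ℝ} {x₀ : Fin d → ℝ} {α : ℝ} (hα : 0 ≤ α)
    (hf : HolderAt f x₀ α) : (α : EReal) ≤ holderExp f x₀ :=
  le_sSup ⟨α, hα, hf, rfl⟩

theorem holderAt_zero {d : ℕ} {f : (Fin d → ℝ) → ℝ} {x₀ : Fin d → ℝ} {M r₀ : ℝ} (hr₀ : 0 < r₀)
    (hM : ∀ x ∈ Metric.ball x₀ r₀, |f x| ≤ M) : HolderAt f x₀ 0 := by
  refine ⟨|M| + 1, r₀ / 2, by positivity, by positivity, 0, by simp, fun x hx => ?_⟩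
  have := hM x (by rw [mem_ball_iff_norm]; linarith)
  rw [map_zero, sub_zero, Real.rpow_zero, mul_one]
  linarith [le_abs_self M]

theorem log_two_zpow_neg (j : ℕ) : Real.log ((2 : ℝ) ^ (-(j : ℤ))) = -(j * Real.log 2) := by
  rw [Real.log_zpow]; push_cast; ring

theorem log_half_rpow_pow (α : ℝ) (j : ℕ) :
    Real.log (((1 / 2 : ℝ) ^ α) ^ j) = -(α * (j * Real.log 2)) := by
  rw [Real.log_pow, Real.log_rpow (by norm_num), one_div, Real.log_inv]; ring

/-- For a locally bounded `f` on an open set `Ω`, `x₀ ∈ Ω`, and `l ∈ ℕ` with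
`l > h_f(x₀)`, the pointwise Hölder exponent is recovered from the decay of the
oscillations of order `l` on the enlarged dyadic cubes containing `x₀`:
`h_f(x₀) = liminf_{j→∞} log Osc^l_f(3λ_j(x₀)) / log 2^{-j}`, the liminf taken over
those `j` with `3λ_j(x₀) ⊆ Ω` (and with the convention `log 0 = −∞`, giving `+∞`
for vanishing oscil). -/
theorem holderExp_eq_liminf_oscillation {d : ℕ} (Ω : Set (Fin d → ℝ))
    (hΩ : IsOpen Ω) (f : (Fin d → ℝ) → ℝ)
    (hloc : ∀ x ∈ Ω, ∃ r : ℝ, 0 < r ∧ Metric.ball x r ⊆ Ω ∧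
      Bornology.IsBounded (f '' Metric.ball x r))
    (x₀ : Fin d → ℝ) (hx₀ : x₀ ∈ Ω) (l : ℕ)
    (hl : holderExp f x₀ < ((l : ℝ) : EReal)) :
    holderExp f x₀ =
      Filter.liminf
        (fun j : ℕ =>
          if oscil l f (threeCube d j (dyadicIndex d j x₀)) = 0 then (⊤ : EReal)
          else ((Real.log (oscil l f (threeCube d j (dyadicIndex d j x₀))) /
              Real.log ((2 : ℝ) ^ (-(j : ℤ))) : ℝ) : EReal))
        (Filter.atTop ⊓
          Filter.principal {j : ℕ | threeCube d j (dyadicIndex d j x₀) ⊆ Ω}) := by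
  obtain ⟨r₀, hr₀, hball, hbdd⟩ := hloc x₀ hx₀
  obtain ⟨M, hM'⟩ := hbdd.exists_norm_le
  have hM : ∀ x ∈ Metric.ball x₀ r₀, |f x| ≤ M := fun x hx => hM' _ ⟨x, hx, rfl⟩
  have h0 : (0 : EReal) ≤ holderExp f x₀ := le_holderExp le_rfl (holderAt_zero hr₀ hM)
  have hl0 : 0 < l := by
    have := h0.trans_lt hl
    exact_mod_cast this
  have ht : Tendsto (fun j : ℕ => 2 * (1 / 2 : ℝ) ^ j) atTop (𝓝 0) := by
    simpa using (tendsto_pow_atTop_nhds_zero_of_lt_one (r := (1 / 2 : ℝ)) (by norm_num)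
      (by norm_num)).const_mul 2
  have hfilter : (atTop : Filter ℕ) ⊓
      Filter.principal {j : ℕ | threeCube d j (dyadicIndex d j x₀) ⊆ Ω} = atTop := by
    refine inf_of_le_left (le_principal_iff.2 ?_)
    filter_upwards [ht.eventually (gt_mem_nhds hr₀)] with j hj z hz
    exact hball (by
      rw [mem_ball_iff_norm]; exact (norm_sub_le_of_mem_threeCube hz).trans_lt hj)
  have hlog2 : 0 < Real.log 2 := Real.log_pos one_lt_two
  rw [hfilter]
  apply le_antisymm
  · refine sSup_le ?_
    rintro _ ⟨α, hα, hfα, rfl⟩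
    have hαl : α < l := by exact_mod_cast (le_holderExp hα hfα).trans_lt hl
    obtain ⟨A, hA, hosc⟩ := hfα.exists_oscil_threeCube_le hα hαl
    refine le_of_forall_lt fun β hβ => ?_
    obtain ⟨γ, hβγ, hγα⟩ := EReal.lt_iff_exists_real_btwn.1 hβ
    rw [EReal.coe_lt_coe_iff] at hγα
    refine hβγ.trans_le (le_liminf_of_le (by isBoundedDefault) ?_)
    have ht2 : Tendsto (fun j : ℕ => (α - γ) * ((j : ℝ) * Real.log 2)) atTop atTop :=
      (tendsto_natCast_atTop_atTop.atTop_mul_const hlog2).const_mul_atTop (by linarith)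
    filter_upwards [hosc, ht2.eventually_ge_atTop (Real.log A), eventually_gt_atTop 0]
      with j hj hjA hj0
    split_ifs with hz
    · exact le_top
    have hpos := (oscil_nonneg f (threeCube d j (dyadicIndex d j x₀))).lt_of_ne' hz
    have hj0' : (0 : ℝ) < j * Real.log 2 := by positivity
    have h1 := Real.log_le_log hpos hj
    rw [Real.log_mul hA.ne' (by positivity), log_half_rpow_pow] at h1
    rw [EReal.coe_le_coe_iff, log_two_zpow_neg, div_neg, ← neg_div, le_div_iff₀ hj0']
    linarith
  · by_contra! hlt
    obtain ⟨a, ha1, ha2⟩ := EReal.lt_iff_exists_real_btwn.1 hlt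
    obtain ⟨b, hb1, hb2⟩ := EReal.lt_iff_exists_real_btwn.1 ha1
    obtain ⟨α, hα, hbα, hαa⟩ := exists_irrational_btwn (EReal.coe_lt_coe_iff.1 hb2)
    have hα0 : 0 < α := lt_trans (by exact_mod_cast h0.trans_lt hb1) hbα
    have hev := eventually_lt_of_lt_liminf ((EReal.coe_lt_coe_iff.2 hαa).trans ha2)
    have hosc : ∀ᶠ j : ℕ in atTop,
        oscil l f (threeCube d j (dyadicIndex d j x₀)) ≤ ((1 / 2 : ℝ) ^ α) ^ j := by
      filter_upwards [hev, eventually_gt_atTop 0] with j hj hj0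
      split_ifs at hj with hz
      · rw [hz]; positivity
      have hpos := (oscil_nonneg f (threeCube d j (dyadicIndex d j x₀))).lt_of_ne' hz
      have hj0' : (0 : ℝ) < j * Real.log 2 := by positivity
      rw [EReal.coe_lt_coe_iff, log_two_zpow_neg, div_neg, ← neg_div, lt_div_iff₀ hj0'] at hj
      rw [← Real.log_le_log_iff hpos (by positivity), log_half_rpow_pow]
      linarith
    have hH := holderAt_of_oscil_threeCube_le hl0 hα0 (fun n => (hα.ne_nat n).symm) hr₀ hM hosc
    exact absurd ((le_holderExp hα0.le hH).trans_lt (hb1.trans (EReal.coe_lt_coe_iff.2 hbα)))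
      (lt_irrefl _)

end
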